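/- (Hou–Sun) Let F be a field, S_{ij} (1 ≤ i ≠ j ≤ n) subsets of F with |S_{ij}| = m, and A_1, ..., A_n ⊆ F with |A_1| = ... = |A_n| = k. Define C = {a_1 + ... + a_n : a_j ∈ A_j, a_i − a_j ∉ S_{ij} if i ≠ j}. If p(F) > max{n(k−1) − mn(n−1), mn}, then |C| ≥ n(k−1) − mn(n−1) + 1. -/

import Mathlib

open Finset

section HSHelpers
open MvPolynomial

def HSSmall {σ F : Type*} [Field F] (d : ℕ) (R : MvPolynomial σ F) : Prop :=
  ∀ a : σ →₀ ℕ, d ≤ a.degree → coeff a R = 0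

def HSLead {σ F : Type*} [Field F] (d : ℕ) (P H : MvPolynomial σ F) : Prop :=
  HSSmall (d + 1) H ∧ HSSmall d (P - H)

theorem HSSmall.add {σ F : Type*} [Field F] {d : ℕ} {R Q : MvPolynomial σ F}
    (h : HSSmall d R) (h' : HSSmall d Q) : HSSmall d (R + Q) := by
  intro a ha
  rw [coeff_add, h a ha, h' a ha, add_zero]

theorem HSSmall.mono {σ F : Type*} [Field F] {d e : ℕ} {R : MvPolynomial σ F}
    (h : HSSmall d R) (hde : d ≤ e) : HSSmall e R := fun a ha => h a (hde.trans ha)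

theorem HSSmall.mul {σ F : Type*} [Field F] {d e f : ℕ} {R Q : MvPolynomial σ F}
    (h : HSSmall d R) (h' : HSSmall e Q) (hf : d + e ≤ f + 1) : HSSmall f (R * Q) := by
  classical
  intro a ha
  rw [coeff_mul]
  apply Finset.sum_eq_zero
  rintro ⟨b, c⟩ hbc
  rw [HasAntidiagonal.mem_antidiagonal] at hbc
  have hd : b.degree + c.degree = a.degree := by rw [← hbc, map_add]
  by_cases hb : d ≤ b.degree
  · simp [h b hb]
  · have := h' c (by omega)
    simp [this]

theorem HSLead.small {σ F : Type*} [Field F] {d : ℕ} {P H : MvPolynomial σ F}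
    (h : HSLead d P H) : HSSmall (d + 1) P := by
  have := (h.2.mono (Nat.le_succ d)).add h.1
  simpa using this

theorem HSLead.mul {σ F : Type*} [Field F] {d e : ℕ} {P H P' H' : MvPolynomial σ F}
    (h : HSLead d P H) (h' : HSLead e P' H') : HSLead (d + e) (P * P') (H * H') := by
  refine ⟨h.1.mul h'.1 (by omega), ?_⟩
  have : P * P' - H * H' = (P - H) * P' + H * (P' - H') := by ring
  rw [this]
  exact (h.2.mul h'.small (by omega)).add (h.1.mul h'.2 (by omega))

theorem HSLead.one {σ F : Type*} [Field F] : HSLead 0 (1 : MvPolynomial σ F) 1 := by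
  refine ⟨?_, ?_⟩
  · intro a ha
    classical
    rw [coeff_one, if_neg]
    rintro rfl
    simp at ha
  · intro a ha
    simp

theorem HSLead.prod {σ F ι : Type*} [Field F] (s : Finset ι) (d : ι → ℕ)
    (P H : ι → MvPolynomial σ F) (h : ∀ i ∈ s, HSLead (d i) (P i) (H i)) :
    HSLead (∑ i ∈ s, d i) (∏ i ∈ s, P i) (∏ i ∈ s, H i) := by
  classical
  induction s using Finset.induction_on with
  | empty => simpa using HSLead.one
  | insert a s ha ih =>
    rw [sum_insert ha, prod_insert ha, prod_insert ha]
    exact (h a (mem_insert_self a s)).mul (ih fun i hi => h i (mem_insert_of_mem hi))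

theorem HSLead.prod_const {σ F ι : Type*} [Field F] (s : Finset ι)
    (P : ι → MvPolynomial σ F) (L : MvPolynomial σ F) (h : ∀ i ∈ s, HSLead 1 (P i) L) :
    HSLead s.card (∏ i ∈ s, P i) (L ^ s.card) := by
  have := HSLead.prod s (fun _ => 1) P (fun _ => L) h
  simpa using this

theorem HSLead.lin {σ F : Type*} [Field F] (L : MvPolynomial σ F) (hL : L.IsHomogeneous 1)
    (c : F) : HSLead 1 (L - C c) L := by
  classical
  refine ⟨?_, ?_⟩
  · intro a ha
    exact hL.coeff_eq_zero (by omega)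
  · intro a ha
    have : L - C c - L = - C c := by ring
    rw [this, coeff_neg, coeff_C, if_neg, neg_zero]
    rintro rfl
    simp at ha

theorem HSSmall.null {σ F : Type*} [Field F] [Finite σ] (P : MvPolynomial σ F)
    (t : σ →₀ ℕ) (h : HSSmall (t.degree + 1) P) (ht : coeff t P ≠ 0)
    (S : σ → Finset F) (htS : ∀ i, t i < (S i).card) :
    ∃ s : σ → F, (∀ i, s i ∈ S i) ∧ eval s P ≠ 0 := by
  refine combinatorial_nullstellensatz_exists_eval_nonzero P t ht ?_ S htS
  apply le_antisymm
  · rw [totalDegree]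
    apply Finset.sup_le
    intro b hb
    by_contra hlt
    rw [mem_support_iff] at hb
    apply hb (h b _)
    have : b.degree = b.sum fun _ e => e := rfl
    omega
  · exact le_totalDegree (mem_support_iff.2 ht)

theorem hs_cast {F : Type*} [Field F] (z B : ℤ) (hp : ringChar F = 0 ∨ B < (ringChar F : ℤ))
    (hz : |z| ≤ B) (h : (z : F) = 0) : z = 0 := by
  rw [CharP.intCast_eq_zero_iff F (ringChar F)] at h
  rcases hp with hp | hp
  · rw [hp] at h; simpa using h
  · exact Int.eq_zero_of_abs_lt_dvd h (by omega)

theorem hs_comb (n m : ℕ) (K : ℤ) (c : Fin (n + 1) → ℤ) (h0 : ∀ i, 0 ≤ c i) (hK : ∀ i, c i ≤ K)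
    (h1 : ∀ i j, i < j → ∀ l : ℕ, l < m → c i - c j ≠ l + 1)
    (h2 : ∀ i j, i < j → ∀ l : ℕ, l < m → c j - c i ≠ l) :
    (∑ i : Fin (n + 1), (i : ℤ) * m) ≤ ∑ i, c i ∧
    (∑ i, c i ≤ (n + 1) * K - ∑ i : Fin (n + 1), (i : ℤ) * m) ∧
    (∑ i, c i = (∑ i : Fin (n + 1), (i : ℤ) * m) → ∀ i : Fin (n + 1), c i = (i : ℤ) * m) := by
  set σ := Tuple.sort c with hσ
  have hmono : Monotone (c ∘ σ) := Tuple.monotone_sort c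
  have hlt : ∀ i j : Fin (n + 1), c i ≤ c j → i ≠ j → (m : ℤ) ≤ c j - c i ∧
      (0 < m → j < i → (m : ℤ) < c j - c i) := by
    intro i j hij hne
    rcases lt_or_gt_of_ne hne with h | h
    · have := h2 i j h (c j - c i).toNat
      refine ⟨?_, fun _ h' => absurd h' (not_lt.2 h.le)⟩
      by_contra hh
      exact this (by omega) (by omega)
    · rcases Nat.eq_zero_or_pos m with hm | hm
      · subst hm; exact ⟨by simpa using hij, fun h => absurd h (lt_irrefl 0)⟩
      · have e1 : c j - c i ≠ 0 := by
          intro h0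
          exact h2 j i h 0 hm (by push_cast; omega)
        have : (m : ℤ) < c j - c i := by
          by_contra hh
          exact h1 j i h (c j - c i - 1).toNat (by omega) (by omega)
        exact ⟨this.le, fun _ _ => this⟩
  have hstep : ∀ i : Fin n, (m : ℤ) ≤ c (σ i.succ) - c (σ i.castSucc) ∧
      (0 < m → σ i.succ < σ i.castSucc → (m : ℤ) < c (σ i.succ) - c (σ i.castSucc)) := by
    intro i
    apply hlt
    · exact hmono (Fin.castSucc_lt_succ).le
    · intro h
      exact (Fin.castSucc_lt_succ (i := i)).ne (σ.injective h)
  have hg : Monotone (fun i : Fin (n + 1) => c (σ i) - (i : ℤ) * m) := by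
    rw [Fin.monotone_iff_le_succ]
    intro i
    have := (hstep i).1
    simp only [Fin.val_castSucc, Fin.val_succ]
    push_cast
    linarith
  have hlow : ∀ i : Fin (n + 1), (i : ℤ) * m ≤ c (σ i) := by
    intro i
    have := hg (Fin.zero_le i)
    have h00 := h0 (σ 0)
    simp at this
    linarith
  have hup : ∀ i : Fin (n + 1), c (σ i) ≤ K - (n - (i : ℤ)) * m := by
    intro i
    have := hg (Fin.le_last i)
    have h00 := hK (σ (Fin.last n))
    simp at this
    linarith
  have hsum : ∑ i, c (σ i) = ∑ i, c i := Equiv.sum_comp σ c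
  rw [← hsum]
  refine ⟨Finset.sum_le_sum fun i _ => hlow i, ?_, ?_⟩
  · refine (Finset.sum_le_sum fun i _ => hup i).trans ?_
    rw [Finset.sum_sub_distrib]
    have : ∑ i : Fin (n + 1), ((n : ℤ) - (i : ℤ)) * m = ∑ i : Fin (n + 1), (i : ℤ) * m := by
      rw [← Equiv.sum_comp Fin.revPerm]
      refine Finset.sum_congr rfl fun i _ => ?_
      simp only [Fin.revPerm_apply, Fin.val_rev]
      have := i.2
      rw [Nat.cast_sub (by omega)]
      push_cast
      ring
    rw [this]
    simp
  · intro heq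
    have hall : ∀ i, c (σ i) = (i : ℤ) * m := by
      have := (Finset.sum_eq_sum_iff_of_le (s := univ) fun i _ => hlow i).1 heq.symm
      intro i
      exact (this i (mem_univ i)).symm
    rcases Nat.eq_zero_or_pos m with hm | hm
    · intro i
      have := hall (σ.symm i)
      simpa [hm] using this
    · have hs : StrictMono σ := by
        rw [Fin.strictMono_iff_lt_succ]
        intro i
        by_contra hh
        have hne : σ i.succ ≠ σ i.castSucc := fun h =>
          (Fin.castSucc_lt_succ (i := i)).ne' (σ.injective h)
        have := (hstep i).2 hm (lt_of_le_of_ne (not_lt.1 hh) hne)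
        rw [hall, hall] at this
        simp only [Fin.val_castSucc, Fin.val_succ] at this
        push_cast at this
        linarith
      intro i
      have e : σ i = i := le_antisymm (hs.apply_le) (hs.le_apply)
      have := hall i
      rwa [e] at this

theorem hs_lead {F ι : Type*} [Field F] (n m : ℕ) (T : Fin n → Fin n → Finset ι)
    (v : Fin n → Fin n → ι → F) (hT : ∀ i j, i ≠ j → (T i j).card = m) :
    HSLead (∑ i : Fin n, ∑ _j ∈ univ.erase i, m)
      (∏ i : Fin n, ∏ j ∈ univ.erase i, ∏ s ∈ T i j, (X i - X j - C (v i j s)))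
      (∏ i : Fin n, ∏ j ∈ univ.erase i, (X i - X j) ^ m : MvPolynomial (Fin n) F) := by
  refine HSLead.prod _ _ _ _ fun i _ => HSLead.prod _ _ _ _ fun j hj => ?_
  have hc := hT i j (ne_of_mem_erase hj).symm
  have := HSLead.prod_const (T i j) (fun s => X i - X j - C (v i j s)) (X i - X j)
    (fun s _ => HSLead.lin (σ := Fin n) (F := F) _
      ((isHomogeneous_X F i).sub (isHomogeneous_X F j)) (v i j s))
  rwa [hc] at this

theorem hs_lead2 {F ι : Type*} [Field F] (n : ℕ) (T : Finset ι) (v : ι → F) :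
    HSLead T.card (∏ s ∈ T, ((∑ i : Fin n, X i) - C (v s)))
      ((∑ i : Fin n, X i) ^ T.card : MvPolynomial (Fin n) F) :=
  HSLead.prod_const T _ _ fun s _ => HSLead.lin _
    (IsHomogeneous.sum _ _ _ fun i _ => isHomogeneous_X F i) (v s)

theorem hs_coeff {F : Type*} [Field F] [DecidableEq F] (n m K N M : ℕ)
    (hM : M = ∑ i : Fin (n + 1), (i : ℕ) * m)
    (hN : N + 2 * M = (n + 1) * K) (hK : n * m ≤ K) (t : Fin (n + 1) →₀ ℕ)
    (ht : ∀ i, t i = K)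
    (hdeg : (∑ i : Fin (n + 1), ∑ _j ∈ univ.erase i, m) + N = t.degree)
    (hp : ∃ B : ℤ, (N : ℤ) ≤ B ∧ (m : ℤ) * (n + 1) ≤ B ∧ (K : ℤ) ≤ B ∧
      (ringChar F = 0 ∨ B < (ringChar F : ℤ))) :
    coeff t ((∏ i : Fin (n + 1), ∏ j ∈ univ.erase i, (X i - X j) ^ m) *
      (∑ i : Fin (n + 1), X i) ^ N : MvPolynomial (Fin (n + 1)) F) ≠ 0 := by
  obtain ⟨B, hB1, hB2, hB3, hp⟩ := hp
  intro hcoef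
  set P : MvPolynomial (Fin (n + 1)) F :=
    (∏ i : Fin (n + 1), ∏ j ∈ univ.erase i, ∏ s ∈ range m,
      (X i - X j - C (((s + if i < j then 1 else 0 : ℕ) : ℤ) : F))) *
    (∏ s ∈ range N, ((∑ i : Fin (n + 1), X i) - C (((M + 1 + s : ℕ) : ℤ) : F))) with hP
  have hPl : HSLead t.degree P ((∏ i : Fin (n + 1), ∏ j ∈ univ.erase i, (X i - X j) ^ m) *
      (∑ i : Fin (n + 1), X i) ^ N : MvPolynomial (Fin (n + 1)) F) := by
    have := (hs_lead (F := F) (n + 1) m (fun _ _ => range m)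
      (fun i j s => (((s + if i < j then 1 else 0 : ℕ) : ℤ) : F)) (by simp)).mul
      (hs_lead2 (n + 1) (range N) (fun s => (((M + 1 + s : ℕ) : ℤ) : F)))
    rw [card_range, hdeg] at this
    exact this
  have hPc : coeff t P = 0 := by
    have := hPl.2 t le_rfl
    rw [coeff_sub, hcoef, sub_zero] at this
    exact this
  have hinj : ∀ a b : ℤ, 0 ≤ a → a ≤ K → 0 ≤ b → b ≤ K → (a : F) = b → a = b := by
    intro a b h1 h2 h3 h4 h
    have := hs_cast (F := F) (a - b) B hp (by rw [abs_le]; omega) (by push_cast; rw [h, sub_self])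
    omega
  set G : Finset F := (range (K + 1)).image (fun a : ℕ => ((a : ℤ) : F)) with hG
  have hGc : G.card = K + 1 := by
    rw [hG, card_image_of_injOn, card_range]
    intro a ha b hb hab
    simp only [coe_range, Set.mem_Iio] at ha hb
    have := hinj a b (by omega) (by omega) (by omega) (by omega) hab
    omega
  set x : Fin (n + 1) → F := fun i => (((i : ℕ) * m : ℕ) : ℤ) with hx
  have hxG : ∀ i, x i ∈ G := by
    intro i
    refine mem_image.2 ⟨(i : ℕ) * m, ?_, rfl⟩
    have : (i : ℕ) * m ≤ n * m := Nat.mul_le_mul_right _ (by omega)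
    rw [mem_range]; omega
  -- the delta polynomial
  set D : MvPolynomial (Fin (n + 1)) F := ∏ i, ∏ s ∈ G.erase (x i), (X i - C s) with hD
  have hDl : HSLead t.degree D (∏ i, X i ^ K) := by
    have : HSLead (∑ i : Fin (n + 1), (G.erase (x i)).card) D
        (∏ i, X i ^ (G.erase (x i)).card) :=
      HSLead.prod _ _ _ _ fun i _ => HSLead.prod_const _ _ _ fun s _ =>
        HSLead.lin _ (isHomogeneous_X F i) s
    have hc : ∀ i, (G.erase (x i)).card = K := by
      intro i; rw [card_erase_of_mem (hxG i), hGc]; rfl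
    simp only [hc] at this
    rw [Finsupp.degree_eq_sum]
    simpa only [ht] using this
  have hDc : coeff t D = 1 := by
    have := hDl.2 t le_rfl
    rw [coeff_sub, sub_eq_zero] at this
    rw [this]
    have h2 : (∏ i, X i ^ K : MvPolynomial (Fin (n + 1)) F) = monomial t 1 := by
      rw [monomial_eq, C_1, one_mul, Finsupp.prod_fintype _ _ (by simp)]
      simp [ht]
    rw [h2, coeff_monomial, if_pos rfl]
  have hDx : eval x D ≠ 0 := by
    rw [hD]
    simp only [map_prod, map_sub, eval_X, eval_C]
    refine prod_ne_zero_iff.2 fun i _ => prod_ne_zero_iff.2 fun s hs => ?_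
    exact sub_ne_zero.2 (ne_of_mem_erase hs).symm
  have hDy : ∀ y : Fin (n + 1) → F, (∀ i, y i ∈ G) → y ≠ x → eval y D = 0 := by
    intro y hy hne
    obtain ⟨i, hi⟩ := Function.ne_iff.1 hne
    rw [hD]
    simp only [map_prod, map_sub, eval_X, eval_C]
    refine prod_eq_zero (mem_univ i) (prod_eq_zero (mem_erase.2 ⟨hi, hy i⟩) (sub_self _))
  have hPx : eval x P ≠ 0 := by
    rw [hP]
    simp only [map_mul, map_prod, map_sub, eval_X, eval_C, map_sum]
    refine mul_ne_zero (prod_ne_zero_iff.2 fun i _ => prod_ne_zero_iff.2 fun j hj =>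
      prod_ne_zero_iff.2 fun s hs => ?_) (prod_ne_zero_iff.2 fun s hs => ?_)
    · rw [mem_range] at hs
      intro h
      have hij := ne_of_mem_erase hj
      simp only [hx] at h
      rw [← Int.cast_sub, ← Int.cast_sub] at h
      have hi := i.2
      have hj' := j.2
      rcases lt_or_gt_of_ne hij with hlt | hlt
      · have hle : (j : ℕ) + 1 ≤ i := hlt
        obtain ⟨e, he⟩ := Nat.exists_eq_add_of_le hle
        rw [if_neg (not_lt.2 hlt.le), he] at h
        have hen : e * m ≤ (n - 1) * m := Nat.mul_le_mul_right _ (by omega)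
        have hn1 : (n - 1) * m + 2 * m = m * (n + 1) := by
          obtain ⟨q, rfl⟩ : ∃ q, n = q + 1 := ⟨n - 1, by omega⟩
          simp; ring
        have h3 : (((((j : ℕ) + 1 + e) * m : ℕ) : ℤ) - ((((j : ℕ) * m : ℕ)) : ℤ)
          - ((s + 0 : ℕ) : ℤ)) = ((e * m + m : ℕ) : ℤ) - s := by push_cast; ring
        rw [h3] at h
        have := hs_cast _ B hp (by rw [abs_le]; zify at hen hn1; constructor <;> push_cast <;> nlinarith) h
        push_cast at this
        nlinarith
      · have hle : (i : ℕ) + 1 ≤ j := hlt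
        obtain ⟨e, he⟩ := Nat.exists_eq_add_of_le hle
        rw [if_pos hlt, he] at h
        have hen : e * m ≤ (n - 1) * m := Nat.mul_le_mul_right _ (by omega)
        have hn1 : (n - 1) * m + 2 * m = m * (n + 1) := by
          obtain ⟨q, rfl⟩ : ∃ q, n = q + 1 := ⟨n - 1, by omega⟩
          simp; ring
        have h3 : (((((i : ℕ) * m : ℕ)) : ℤ) - ((((i : ℕ) + 1 + e) * m : ℕ) : ℤ)
          - ((s + 1 : ℕ) : ℤ)) = - (((e * m + m + s + 1 : ℕ) : ℤ)) := by push_cast; ring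
        rw [h3] at h
        have hb : ((e * m + m + s + 1 : ℕ) : ℤ) ≤ B := by
          have : e * m + m + s + 1 ≤ m * (n + 1) := by omega
          zify at this
          push_cast
          linarith
        have := hs_cast _ B hp (by rw [abs_neg, Nat.abs_cast]; exact hb) h
        omega
    · rw [mem_range] at hs
      intro h
      simp only [hx] at h
      rw [← Int.cast_sum, ← Nat.cast_sum, ← hM, ← Int.cast_sub] at h
      have := hs_cast _ B hp (by rw [abs_le]; push_cast; omega) h
      push_cast at this
      omega
  have hPy : ∀ y : Fin (n + 1) → F, (∀ i, y i ∈ G) → y ≠ x → eval y P = 0 := by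
    intro y hy hne
    by_contra hPy
    apply hne
    have hy' : ∀ i, ∃ a : ℕ, a ≤ K ∧ ((a : ℤ) : F) = y i := by
      intro i
      obtain ⟨a, ha, h⟩ := mem_image.1 (hy i)
      exact ⟨a, by rw [mem_range] at ha; omega, h⟩
    choose c hcK hc using hy'
    rw [hP] at hPy
    simp only [map_mul, map_prod, map_sub, eval_X, eval_C, map_sum] at hPy
    obtain ⟨hP1, hP2⟩ := mul_ne_zero_iff.1 hPy
    have hne1 : ∀ i j, i ≠ j → ∀ s, s < m →
        y i - y j - ((((s + if i < j then 1 else 0 : ℕ) : ℤ)) : F) ≠ 0 := by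
      intro i j hij s hs
      have a1 := prod_ne_zero_iff.1 hP1 i (mem_univ i)
      have a2 := prod_ne_zero_iff.1 a1 j (mem_erase.2 ⟨hij.symm, mem_univ j⟩)
      exact prod_ne_zero_iff.1 a2 s (mem_range.2 hs)
    obtain ⟨h1, h2, h3⟩ := hs_comb n m K (fun i => (c i : ℤ)) (by simp)
      (fun i => by exact_mod_cast hcK i)
      (by
        intro i j hij l hl h
        apply hne1 i j hij.ne l hl
        rw [← hc, ← hc, if_pos hij, ← Int.cast_sub, h]
        push_cast; ring)
      (by
        intro i j hij l hl h
        apply hne1 j i hij.ne' l hl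
        rw [← hc, ← hc, if_neg (not_lt.2 hij.le), ← Int.cast_sub, h]
        push_cast; ring)
    have hMz : ∑ i : Fin (n + 1), (i : ℤ) * m = M := by rw [hM]; push_cast; rfl
    rw [hMz] at h1 h2 h3
    have hsum : ∑ i, (c i : ℤ) = M := by
      by_contra hh
      have hq : ∑ i, (c i : ℤ) ≤ M + N := by
        have : (N : ℤ) + 2 * M = (n + 1) * K := by exact_mod_cast hN
        linarith
      have := prod_ne_zero_iff.1 hP2 (∑ i, (c i : ℤ) - M - 1).toNat (mem_range.2 (by omega))
      apply this
      rw [← Finset.sum_congr rfl fun i _ => hc i, ← Int.cast_sum, ← Int.cast_sub]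
      have : ∑ i, (c i : ℤ) - ((M + 1 + (∑ i, (c i : ℤ) - M - 1).toNat : ℕ) : ℤ) = 0 := by
        omega
      rw [this, Int.cast_zero]
    funext i
    rw [← hc, hx, h3 hsum i]
    push_cast; rfl
  -- conclude
  clear_value D P
  set lam := eval x P / eval x D with hlam
  have hQs : HSSmall (t.degree + 1) (P + C (-lam) * D) := by
    refine hPl.small.add ?_
    intro a ha
    rw [coeff_C_mul, hDl.small a ha, mul_zero]
  obtain ⟨y, hyG, hy⟩ := HSSmall.null (P + C (-lam) * D) t hQs
    (by
      rw [coeff_add, coeff_C_mul, hPc, hDc, zero_add, mul_one]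
      exact neg_ne_zero.2 (div_ne_zero hPx hDx))
    (fun _ => G) (fun i => by rw [ht, hGc]; omega)
  apply hy
  by_cases hyx : y = x
  · rw [hyx, eval_add, eval_mul, eval_C, hlam]
    rw [neg_mul, div_mul_cancel₀ _ hDx, add_neg_cancel]
  · rw [eval_add, eval_mul, hPy y hyG hyx, hDy y hyG hyx]
    simp

end HSHelpers


/-- Hou–Sun theorem: if `p(F) > max{n(k-1) - mn(n-1), mn}` then
`|C| ≥ n(k-1) - mn(n-1) + 1`; `ringChar F = 0` encodes `p(F)` infinite. -/
theorem hou_sun {F : Type*} [Field F] [DecidableEq F] (n m k : ℕ) (hn : 1 ≤ n)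
    (S : Fin n → Fin n → Finset F) (hS : ∀ i j : Fin n, i ≠ j → (S i j).card = m)
    (A : Fin n → Finset F) (hAk : ∀ j, (A j).card = k)
    (hp : ringChar F = 0 ∨
      max ((n : ℤ) * (k - 1) - m * n * (n - 1)) ((m : ℤ) * n) < (ringChar F : ℤ)) :
    (n : ℤ) * (k - 1) - m * n * (n - 1) + 1 ≤
      (((Fintype.piFinset A).filter fun f => ∀ i j : Fin n, i ≠ j → f i - f j ∉ S i j).image
        fun f => ∑ i, f i).card := by
  obtain ⟨n, rfl⟩ : ∃ q, n = q + 1 := ⟨n - 1, by omega⟩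
  set Cc := (((Fintype.piFinset A).filter fun f =>
    ∀ i j : Fin (n + 1), i ≠ j → f i - f j ∉ S i j).image fun f => ∑ i, f i) with hCc
  by_contra hcon
  push Not at hcon
  have hcon' : (Cc.card : ℤ) ≤
      ((n + 1 : ℕ) : ℤ) * (k - 1) - m * ((n + 1 : ℕ) : ℤ) * (((n + 1 : ℕ) : ℤ) - 1) := by omega
  have hk : 1 ≤ k := by
    by_contra hk
    have : k = 0 := by omega
    subst this
    push_cast at hcon'
    have : (0 : ℤ) ≤ m * (n + 1) * n := by positivity
    nlinarith
  obtain ⟨K, rfl⟩ : ∃ q, k = q + 1 := ⟨k - 1, by omega⟩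
  obtain ⟨N, hN⟩ := Int.eq_ofNat_of_zero_le ((Int.natCast_nonneg _).trans hcon')
  rw [hN] at hcon' hp
  push_cast at hN hp
  have hcard : Cc.card ≤ N := by exact_mod_cast hcon'
  have hNK : N + m * (n + 1) * n = (n + 1) * K := by
    zify
    linarith
  have hM2 : 2 * (∑ i : Fin (n + 1), (i : ℕ) * m) = m * (n + 1) * n := by
    rw [← Finset.sum_mul, Fin.sum_univ_eq_sum_range (fun i => i) (n + 1), ← mul_assoc, mul_comm 2,
      Finset.sum_range_id_mul_two]
    simp; ring
  have hK : n * m ≤ K := by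
    by_contra hh
    have : (n + 1) * K < (n + 1) * (n * m) := Nat.mul_lt_mul_of_pos_left (by omega) (by omega)
    nlinarith
  set t : Fin (n + 1) →₀ ℕ := Finsupp.equivFunOnFinite.symm (fun _ => K) with htdef
  have ht : ∀ i, t i = K := fun i => rfl
  have hdeg : (∑ i : Fin (n + 1), ∑ _j ∈ univ.erase i, m) + N = t.degree := by
    rw [Finsupp.degree_eq_sum]
    simp [ht]
    linarith
  have hKB : (K : ℤ) ≤ max (N : ℤ) ((m : ℤ) * (n + 1)) := by
    have h1 : (N : ℤ) ≤ max (N : ℤ) ((m : ℤ) * (n + 1)) := le_max_left _ _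
    have h2 : (m : ℤ) * (n + 1) ≤ max (N : ℤ) ((m : ℤ) * (n + 1)) := le_max_right _ _
    have h3 : (N : ℤ) + m * (n + 1) * n = (n + 1) * K := by exact_mod_cast hNK
    have h4 := mul_le_mul_of_nonneg_right h2 (Int.natCast_nonneg n)
    by_contra hh
    push Not at hh
    have h5 := mul_lt_mul_of_pos_left hh (show (0 : ℤ) < n + 1 by positivity)
    nlinarith
  have hco := hs_coeff (F := F) n m K N _ rfl (by rw [hM2]; exact hNK) hK t ht hdeg
    ⟨max (N : ℤ) ((m : ℤ) * (n + 1)), le_max_left _ _, le_max_right _ _, hKB, hp⟩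
  have hL := ((hs_lead (F := F) (n + 1) m S (fun _ _ s => s) hS).mul
    (hs_lead2 (n + 1) Cc (fun s => s))).mul
    (hs_lead2 (F := F) (n + 1) (range (N - Cc.card)) (fun _ => 0))
  rw [mul_assoc, mul_assoc, ← pow_add, add_assoc, card_range, Nat.add_sub_cancel' hcard, hdeg] at hL
  have hPc := hL.2 t le_rfl
  rw [MvPolynomial.coeff_sub, sub_eq_zero] at hPc
  obtain ⟨y, hyA, hy⟩ := HSSmall.null _ t hL.small (by rw [hPc]; exact hco) A
    (fun i => by rw [ht, hAk]; omega)
  simp only [map_mul, map_prod, map_sub, MvPolynomial.eval_X, MvPolynomial.eval_C, map_sum] at hy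
  obtain ⟨hy1, hy2⟩ := mul_ne_zero_iff.1 hy
  obtain ⟨hy2, -⟩ := mul_ne_zero_iff.1 hy2
  have hyC : ∑ i, y i ∈ Cc := by
    refine mem_image.2 ⟨y, mem_filter.2 ⟨Fintype.mem_piFinset.2 hyA, ?_⟩, rfl⟩
    intro i j hij hmem
    have a1 := prod_ne_zero_iff.1 hy1 i (mem_univ i)
    have a2 := prod_ne_zero_iff.1 a1 j (mem_erase.2 ⟨hij.symm, mem_univ j⟩)
    exact prod_ne_zero_iff.1 a2 _ hmem (sub_self _)
  exact prod_ne_zero_iff.1 hy2 _ hyC (sub_self _)
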